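/- arXiv:2507.12019 — 2 statements merged into one kernel-verified Lean document; each statement's English description precedes it below -/
import Mathlib

section
/- Logarithmic potential of the semicircle law at points outside the bulk: for every real a ≥ 1, ∫_{−2}^{2} ln|a + 1/a − x| · (1/(2π))√(4 − x²) dx = ln a + 1/(2a²). -/
open MeasureTheory Real

open Filter Topology

theorem integral_cos_int_mul_zero_pi {m : ℤ} (hm : m ≠ 0) :
    ∫ θ in (0 : ℝ)..π, cos (m * θ) = 0 := by
  have hm' : (m : ℝ) ≠ 0 := by exact_mod_cast hm
  rw [intervalIntegral.integral_comp_mul_left _ hm', integral_cos]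
  simp [sin_int_mul_pi]

theorem sin_sq_mul_cos_nat_mul (n : ℕ) (θ : ℝ) :
    sin θ ^ 2 * cos (n * θ) = 1 / 2 * cos ((n : ℤ) * θ)
      - 1 / 4 * cos ((n + 2 : ℤ) * θ) - 1 / 4 * cos ((n - 2 : ℤ) * θ) := by
  push_cast
  rw [add_mul, sub_mul, cos_add, cos_sub, sin_sq, cos_two_mul]
  ring

theorem integral_sin_sq_mul_cos_nat_mul {n : ℕ} (hn : n ≠ 0) :
    ∫ θ in (0 : ℝ)..π, sin θ ^ 2 * cos (n * θ) = if n = 2 then -(π / 4) else 0 := by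
  have hint (m : ℤ) (k : ℝ) :
      IntervalIntegrable (fun θ : ℝ ↦ k * cos (m * θ)) volume 0 π :=
    Continuous.intervalIntegrable (by fun_prop) _ _
  simp_rw [sin_sq_mul_cos_nat_mul]
  rw [intervalIntegral.integral_sub ((hint _ _).sub (hint _ _)) (hint _ _),
    intervalIntegral.integral_sub (hint _ _) (hint _ _)]
  simp_rw [intervalIntegral.integral_const_mul]
  rw [integral_cos_int_mul_zero_pi (by exact_mod_cast hn),
    integral_cos_int_mul_zero_pi (m := n + 2) (by lia)]
  split_ifs with h
  · subst h
    simp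
    ring
  · rw [integral_cos_int_mul_zero_pi (m := n - 2) (by lia)]
    simp

theorem hasSum_pow_mul_cos_div {r : ℝ} (hr0 : 0 ≤ r) (hr : r < 1) (θ : ℝ) :
    HasSum (fun n : ℕ ↦ r ^ n * cos (n * θ) / n) (-(log (1 + r ^ 2 - 2 * r * cos θ) / 2)) := by
  have hz : ‖(r : ℂ) * Complex.exp (θ * Complex.I)‖ < 1 := by
    simpa [Complex.norm_exp_ofReal_mul_I, abs_of_nonneg hr0] using hr
  convert! Complex.hasSum_re (Complex.hasSum_taylorSeries_neg_log hz) using 1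
  · ext n
    rw [mul_pow, ← Complex.exp_nat_mul, ← mul_assoc, ← Complex.ofReal_natCast,
      ← Complex.ofReal_mul, ← Complex.ofReal_pow, Complex.div_ofReal_re, Complex.re_ofReal_mul,
      Complex.exp_ofReal_mul_I_re]
  · rw [Complex.neg_re, Complex.log_re, neg_inj]
    have : 1 + r ^ 2 - 2 * r * cos θ = ‖1 - (r : ℂ) * Complex.exp (θ * Complex.I)‖ ^ 2 := by
      rw [← Complex.normSq_eq_norm_sq, Complex.normSq_apply, Complex.sub_re, Complex.sub_im,
        Complex.re_ofReal_mul, Complex.im_ofReal_mul,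
        Complex.exp_ofReal_mul_I_re, Complex.exp_ofReal_mul_I_im]
      simp only [Complex.one_re, Complex.one_im]
      linear_combination -r ^ 2 * sin_sq_add_cos_sq θ
    rw [this, log_pow]
    push_cast
    ring

theorem one_add_sq_sub_two_mul_cos_pos {r : ℝ} (hr0 : 0 ≤ r) (hr : r < 1) (θ : ℝ) :
    0 < 1 + r ^ 2 - 2 * r * cos θ := by
  nlinarith [cos_le_one θ, sq_pos_of_pos (sub_pos.2 hr)]

theorem integral_sin_sq_mul_log {r : ℝ} (hr0 : 0 ≤ r) (hr : r < 1) :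
    ∫ θ in (0 : ℝ)..π, sin θ ^ 2 * log (1 + r ^ 2 - 2 * r * cos θ) = π * r ^ 2 / 4 := by
  have hsum : HasSum (fun n : ℕ ↦ ∫ θ in (0 : ℝ)..π, sin θ ^ 2 * (r ^ n * cos (n * θ) / n))
      (∫ θ in (0 : ℝ)..π, sin θ ^ 2 * -(log (1 + r ^ 2 - 2 * r * cos θ) / 2)) := by
    refine intervalIntegral.hasSum_integral_of_dominated_convergence (fun n _ ↦ r ^ n)
      (fun n ↦ Continuous.aestronglyMeasurable (by fun_prop)) (fun n ↦ .of_forall fun θ _ ↦ ?_)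
      (.of_forall fun _ _ ↦ summable_geometric_of_lt_one hr0 hr) (by simp)
      (.of_forall fun θ _ ↦ (hasSum_pow_mul_cos_div hr0 hr θ).mul_left _)
    rcases n.eq_zero_or_pos with rfl | hn
    · simp
    have hn' : (1 : ℝ) ≤ n := by exact_mod_cast hn
    rw [norm_mul, norm_div, norm_mul, norm_pow, norm_pow, norm_natCast, norm_of_nonneg hr0,
      norm_eq_abs, norm_eq_abs, sq_abs]
    calc sin θ ^ 2 * (r ^ n * |cos (n * θ)| / n) ≤ 1 * (r ^ n * 1 / 1) := by
          gcongr
          · exact sin_sq_le_one θ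
          · exact abs_cos_le_one _
      _ = r ^ n := by ring
  have hterm (n : ℕ) : ∫ θ in (0 : ℝ)..π, sin θ ^ 2 * (r ^ n * cos (n * θ) / n)
      = if n = 2 then -(π * r ^ 2 / 8) else 0 := by
    rcases eq_or_ne n 0 with rfl | hn
    · simp
    have (θ : ℝ) : sin θ ^ 2 * (r ^ n * cos (n * θ) / n)
        = r ^ n / n * (sin θ ^ 2 * cos (n * θ)) := by ring
    simp_rw [this]
    rw [intervalIntegral.integral_const_mul, integral_sin_sq_mul_cos_nat_mul hn]
    split_ifs with h
    · subst h
      push_cast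
      ring
    · simp
  simp_rw [hterm] at hsum
  have h := hsum.unique (hasSum_ite_eq 2 _)
  have hmul (θ : ℝ) : sin θ ^ 2 * -(log (1 + r ^ 2 - 2 * r * cos θ) / 2)
      = -(1 / 2) * (sin θ ^ 2 * log (1 + r ^ 2 - 2 * r * cos θ)) := by ring
  simp_rw [hmul] at h
  rw [intervalIntegral.integral_const_mul] at h
  linarith

theorem integral_log_sub_mul_sqrt_eq {c : ℝ} (hc : 2 < c) :
    ∫ x in (-2 : ℝ)..2, log |c - x| * (1 / (2 * π) * √(4 - x ^ 2))
      = 2 / π * ∫ θ in (0 : ℝ)..π, sin θ ^ 2 * log (c - 2 * cos θ) := by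
  have hsub := intervalIntegral.integral_comp_mul_deriv'' (a := 0) (b := π)
    (f := fun θ ↦ 2 * cos θ) (f' := fun θ ↦ 2 * -sin θ)
    (g := fun x ↦ log |c - x| * (1 / (2 * π) * √(4 - x ^ 2)))
    (by fun_prop) (fun θ _ ↦ ((hasDerivAt_cos θ).const_mul 2).hasDerivWithinAt) (by fun_prop) (by
      refine ContinuousOn.mul (ContinuousOn.log (by fun_prop) ?_) (by fun_prop)
      rintro _ ⟨θ, -, rfl⟩
      have := cos_le_one θ
      exact abs_ne_zero.2 (by dsimp only; linarith))
  simp only [cos_zero, cos_pi, Function.comp_apply, mul_one, mul_neg] at hsub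
  rw [intervalIntegral.integral_symm, ← hsub, ← intervalIntegral.integral_neg,
    ← intervalIntegral.integral_const_mul]
  refine intervalIntegral.integral_congr fun θ hθ ↦ ?_
  rw [Set.uIcc_of_le pi_pos.le] at hθ
  have hs : √(4 - (2 * cos θ) ^ 2) = 2 * sin θ := by
    rw [show 4 - (2 * cos θ) ^ 2 = (2 * sin θ) ^ 2 by
      linear_combination -4 * sin_sq_add_cos_sq θ]
    exact sqrt_sq (mul_nonneg zero_le_two (sin_nonneg_of_mem_Icc hθ))
  have := cos_le_one θ
  simp only [hs]
  rw [abs_of_pos (by linarith)]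
  field_simp

theorem two_le_add_one_div {a : ℝ} (ha : 1 ≤ a) : 2 ≤ a + 1 / a := by
  have : a + 1 / a - 2 = (a - 1) ^ 2 / a := by field_simp; ring
  have : 0 ≤ (a - 1) ^ 2 / a := by positivity
  linarith

theorem semicircle_log_potential_of_one_lt {a : ℝ} (ha : 1 < a) :
    ∫ x in (-2 : ℝ)..2, log |a + 1 / a - x| * (1 / (2 * π) * √(4 - x ^ 2))
      = log a + 1 / (2 * a ^ 2) := by
  have ha0 : 0 < a := by linarith
  have hc : 2 < a + 1 / a := by
    have : a + 1 / a - 2 = (a - 1) ^ 2 / a := by field_simp; ring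
    have : 0 < (a - 1) ^ 2 / a := div_pos (pow_pos (sub_pos.2 ha) 2) ha0
    linarith
  have hr : a⁻¹ < 1 := inv_lt_one_of_one_lt₀ ha
  have hr0 : 0 ≤ a⁻¹ := by positivity
  have hpos := one_add_sq_sub_two_mul_cos_pos hr0 hr
  have hlog (θ : ℝ) : sin θ ^ 2 * log (a + 1 / a - 2 * cos θ)
      = sin θ ^ 2 * log a + sin θ ^ 2 * log (1 + a⁻¹ ^ 2 - 2 * a⁻¹ * cos θ) := by
    rw [← mul_add, ← log_mul ha0.ne' (hpos θ).ne']
    congr 2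
    field_simp
  rw [integral_log_sub_mul_sqrt_eq hc]
  simp_rw [hlog]
  rw [intervalIntegral.integral_add, integral_sin_sq_mul_log hr0 hr,
    intervalIntegral.integral_mul_const, integral_sin_sq]
  · simp
    field_simp
    ring
  · exact Continuous.intervalIntegrable (by fun_prop) _ _
  · refine Continuous.intervalIntegrable ?_ _ _
    exact (by fun_prop : Continuous fun θ ↦ sin θ ^ 2).mul
      (Continuous.log (by fun_prop) fun θ ↦ (hpos θ).ne')

theorem abs_log_add_le {s t : ℝ} (ht : 0 < t) (hts : t ≤ s) {M : ℝ} (hM : 1 ≤ M) (hs : s ≤ M) :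
    |log s| ≤ |log t| + log M := by
  have h₁ := log_le_log ht hts
  have h₂ := log_le_log (ht.trans_le hts) hs
  have h₃ := log_nonneg hM
  rw [abs_le]
  constructor <;> linarith [neg_abs_le (log t), abs_nonneg (log t)]

theorem tendsto_integral_log_sub_mul_sqrt :
    Tendsto (fun c ↦ ∫ x in (-2 : ℝ)..2, log |c - x| * (1 / (2 * π) * √(4 - x ^ 2)))
      (𝓝[≥] 2) (𝓝 (∫ x in (-2 : ℝ)..2, log |2 - x| * (1 / (2 * π) * √(4 - x ^ 2)))) := by
  have hlt {x : ℝ} (hx : x ∈ Set.uIoc (-2 : ℝ) 2) (hx2 : x ≠ 2) : -2 < x ∧ x < 2 := by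
    rw [Set.uIoc_of_le (by norm_num)] at hx
    exact ⟨hx.1, lt_of_le_of_ne hx.2 hx2⟩
  have hne : ∀ᵐ x : ℝ, x ≠ 2 := Measure.ae_ne volume 2
  refine intervalIntegral.tendsto_integral_filter_of_dominated_convergence
    (fun x ↦ |log (2 - x)| + log 5) (.of_forall fun c ↦ ?_) ?_ ?_ ?_
  · exact Measurable.aestronglyMeasurable (by fun_prop)
  · filter_upwards [self_mem_nhdsWithin,
      mem_nhdsWithin_of_mem_nhds (Iic_mem_nhds (by norm_num : (2 : ℝ) < 3))] with c hc hc3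
    filter_upwards [hne] with x hx2 hx
    obtain ⟨hx₁, hx₂⟩ := hlt hx hx2
    simp only [Set.mem_Ici, Set.mem_Iic] at hc hc3
    have hw : ‖1 / (2 * π) * √(4 - x ^ 2)‖ ≤ 1 := by
      have hsq : √(4 - x ^ 2) ≤ 2 := by
        rw [sqrt_le_left zero_le_two]
        nlinarith [sq_nonneg x]
      rw [norm_of_nonneg (by positivity), one_div_mul_eq_div, div_le_one (by positivity)]
      linarith [pi_gt_three]
    rw [norm_mul, log_abs, norm_eq_abs (log _)]
    calc |log (c - x)| * ‖1 / (2 * π) * √(4 - x ^ 2)‖ ≤ |log (c - x)| * 1 := by gcongr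
      _ ≤ |log (2 - x)| + log 5 := by
        rw [mul_one]
        exact abs_log_add_le (by linarith) (by linarith) (by norm_num) (by linarith)
  · have h := (intervalIntegral.intervalIntegrable_log' (a := 0) (b := 4)).comp_sub_left 2
    norm_num at h
    exact h.symm.abs.add intervalIntegrable_const
  · filter_upwards [hne] with x hx2 hx
    have hx' : |2 - x| ≠ 0 := abs_ne_zero.2 (sub_ne_zero.2 hx2.symm)
    refine Tendsto.mul_const _ (Tendsto.log ?_ hx')
    exact (Continuous.tendsto (by fun_prop : Continuous fun c : ℝ ↦ |c - x|) 2).mono_left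
      nhdsWithin_le_nhds

/-- **Logarithmic potential of the semicircle law outside the bulk.**  For every `a ≥ 1`,
`∫_{−2}^{2} ln|a + 1/a − x| · (2π)⁻¹ √(4 − x²) dx = ln a + 1/(2a²)`. -/
theorem semicircle_log_potential (a : ℝ) (ha : 1 ≤ a) :
    ∫ x in Set.Icc (-2 : ℝ) 2,
        Real.log |a + 1 / a - x| * (1 / (2 * Real.pi) * Real.sqrt (4 - x ^ 2))
      = Real.log a + 1 / (2 * a ^ 2) := by
  rw [integral_Icc_eq_integral_Ioc, ← intervalIntegral.integral_of_le (by norm_num)]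
  rcases ha.eq_or_lt with rfl | ha
  · have hcont : ContinuousAt (fun b : ℝ ↦ b + 1 / b) 1 := by fun_prop (disch := norm_num)
    have hlim : Tendsto (fun b : ℝ ↦ b + 1 / b) (𝓝[>] 1) (𝓝[≥] 2) := by
      refine tendsto_nhdsWithin_iff.2 ⟨?_, ?_⟩
      · simpa [one_add_one_eq_two] using hcont.tendsto.mono_left nhdsWithin_le_nhds
      · filter_upwards [self_mem_nhdsWithin] with b hb using two_le_add_one_div (le_of_lt hb)
    have hrhs : ContinuousAt (fun b : ℝ ↦ log b + 1 / (2 * b ^ 2)) 1 := by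
      fun_prop (disch := norm_num)
    have heq := tendsto_nhds_unique_of_eventuallyEq
      (tendsto_integral_log_sub_mul_sqrt.comp hlim)
      (hrhs.tendsto.mono_left nhdsWithin_le_nhds)
      (by filter_upwards [self_mem_nhdsWithin] with b hb using semicircle_log_potential_of_one_lt hb)
    rwa [div_one, one_add_one_eq_two]
  · exact semicircle_log_potential_of_one_lt ha
end

section
/- Stieltjes transform of the semicircle law: for every real z > 2, ∫_{−2}^{2} (z − x)^{−1} · (1/(2π))√(4 − x²) dx = (z − √(z² − 4))/2. -/
open MeasureTheory Real

/-- A primitive of `x ↦ √(4 - x²) / (z - x)` on `(-2, 2)`, for `z > 2`. -/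
noncomputable def semicirclePrimitive (z x : ℝ) : ℝ :=
  z * arcsin (x / 2) - √(4 - x ^ 2) - √(z ^ 2 - 4) * arcsin ((z * x - 4) / (2 * (z - x)))

theorem continuousOn_semicirclePrimitive {z : ℝ} (hz : 2 < z) :
    ContinuousOn (semicirclePrimitive z) (Set.Icc (-2) 2) := by
  have hquot : ContinuousOn (fun x : ℝ => (z * x - 4) / (2 * (z - x))) (Set.Icc (-2) 2) :=
    ContinuousOn.div (by fun_prop) (by fun_prop) fun x hx => by linarith [hx.2]
  have harc : ContinuousOn (fun x : ℝ => arcsin ((z * x - 4) / (2 * (z - x)))) (Set.Icc (-2) 2) :=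
    continuous_arcsin.comp_continuousOn hquot
  have hhalf : Continuous fun x : ℝ => arcsin (x / 2) := continuous_arcsin.comp (by fun_prop)
  unfold semicirclePrimitive
  exact (Continuous.continuousOn (by fun_prop)).sub (continuousOn_const.mul harc)

theorem hasDerivAt_arcsin_of_sq_add_sq {f : ℝ → ℝ} {f' x c : ℝ} (hf : HasDerivAt f f' x)
    (hc : 0 < c) (h : f x ^ 2 + c ^ 2 = 1) :
    HasDerivAt (fun y => arcsin (f y)) (f' / c) x := by
  have hsqrt : √(1 - f x ^ 2) = c := by
    rw [show 1 - f x ^ 2 = c ^ 2 by linarith, sqrt_sq hc.le]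
  have hne₁ : f x ≠ -1 := fun h' => by rw [h'] at h; nlinarith
  have hne₂ : f x ≠ 1 := fun h' => by rw [h'] at h; nlinarith
  refine ((hasDerivAt_arcsin hne₁ hne₂).comp x hf).congr_deriv ?_
  rw [hsqrt]
  ring

theorem hasDerivAt_semicirclePrimitive {z x : ℝ} (hz : 2 < z) (hx : x ∈ Set.Ioo (-2 : ℝ) 2) :
    HasDerivAt (semicirclePrimitive z) ((z - x)⁻¹ * √(4 - x ^ 2)) x := by
  obtain ⟨hx₁, hx₂⟩ := hx
  have hzx : 0 < z - x := by linarith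
  have hx_pos : 0 < 4 - x ^ 2 := by nlinarith
  have hz_pos : 0 < z ^ 2 - 4 := by nlinarith
  have ha : 0 < √(4 - x ^ 2) := sqrt_pos.2 hx_pos
  have hs : 0 < √(z ^ 2 - 4) := sqrt_pos.2 hz_pos
  have ha_sq : √(4 - x ^ 2) ^ 2 = 4 - x ^ 2 := sq_sqrt hx_pos.le
  have hs_sq : √(z ^ 2 - 4) ^ 2 = z ^ 2 - 4 := sq_sqrt hz_pos.le
  have hhalf : HasDerivAt (fun y : ℝ => arcsin (y / 2)) (1 / 2 / (√(4 - x ^ 2) / 2)) x :=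
    hasDerivAt_arcsin_of_sq_add_sq ((hasDerivAt_id' x).div_const 2) (by positivity) (by
      rw [div_pow, div_pow, ha_sq]; ring)
  have hroot : HasDerivAt (fun y : ℝ => √(4 - y ^ 2)) (-(2 * x) / (2 * √(4 - x ^ 2))) x := by
    refine HasDerivAt.sqrt ?_ hx_pos.ne'
    simpa using ((hasDerivAt_id' x).pow 2).const_sub 4
  have hquot : HasDerivAt (fun y : ℝ => (z * y - 4) / (2 * (z - y)))
      ((z ^ 2 - 4) / (2 * (z - x) ^ 2)) x := by
    refine ((((hasDerivAt_id' x).const_mul z).sub_const 4).div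
      (((hasDerivAt_id' x).const_sub z).const_mul 2) (by positivity)).congr_deriv ?_
    field_simp
    ring
  have harc := hasDerivAt_arcsin_of_sq_add_sq
    (c := √(z ^ 2 - 4) * √(4 - x ^ 2) / (2 * (z - x))) hquot (by positivity) (by
      rw [div_pow, div_pow, mul_pow (√_), hs_sq, ha_sq]
      field_simp
      ring)
  refine (((hhalf.const_mul z).sub hroot).sub (harc.const_mul √(z ^ 2 - 4))).congr_deriv ?_
  generalize √(4 - x ^ 2) = a at *
  generalize √(z ^ 2 - 4) = s at *
  field_simp
  rw [ha_sq]
  ring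

theorem semicirclePrimitive_two {z : ℝ} (hz : 2 < z) :
    semicirclePrimitive z 2 = (z - √(z ^ 2 - 4)) * (π / 2) := by
  have hquot : (z * 2 - 4) / (2 * (z - 2)) = 1 := by
    rw [div_eq_one_iff_eq (by linarith)]; ring
  rw [semicirclePrimitive, hquot, div_self two_ne_zero, arcsin_one]
  norm_num
  ring

theorem semicirclePrimitive_neg_two {z : ℝ} (hz : 2 < z) :
    semicirclePrimitive z (-2) = -((z - √(z ^ 2 - 4)) * (π / 2)) := by
  have hquot : (z * -2 - 4) / (2 * (z - -2)) = -1 := by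
    rw [div_eq_iff (by linarith)]; ring
  rw [semicirclePrimitive, hquot, neg_div, div_self two_ne_zero, arcsin_neg_one]
  norm_num
  ring

/-- **Stieltjes transform of the semicircle law.**  For every real `z > 2`,
`∫_{−2}^{2} (z − x)⁻¹ · (2π)⁻¹ √(4 − x²) dx = (z − √(z² − 4))/2`. -/
theorem semicircle_stieltjes_transform (z : ℝ) (hz : 2 < z) :
    ∫ x in Set.Icc (-2 : ℝ) 2,
        (z - x)⁻¹ * (1 / (2 * Real.pi) * Real.sqrt (4 - x ^ 2))
      = (z - Real.sqrt (z ^ 2 - 4)) / 2 := by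
  have hle : (-2 : ℝ) ≤ 2 := by norm_num
  have hcont : ContinuousOn (fun x : ℝ => (z - x)⁻¹ * √(4 - x ^ 2)) (Set.Icc (-2) 2) :=
    ContinuousOn.mul (ContinuousOn.inv₀ (by fun_prop) fun x hx => by linarith [hx.2])
      (Continuous.continuousOn (by fun_prop))
  have hint : ∫ x in (-2 : ℝ)..2, (z - x)⁻¹ * √(4 - x ^ 2)
      = semicirclePrimitive z 2 - semicirclePrimitive z (-2) :=
    intervalIntegral.integral_eq_sub_of_hasDerivAt_of_le hle (continuousOn_semicirclePrimitive hz)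
      (fun x hx => hasDerivAt_semicirclePrimitive hz hx) (hcont.intervalIntegrable_of_Icc hle)
  simp_rw [mul_left_comm _ (1 / (2 * π))]
  rw [integral_const_mul, integral_Icc_eq_integral_Ioc, ← intervalIntegral.integral_of_le hle,
    hint, semicirclePrimitive_two hz, semicirclePrimitive_neg_two hz]
  field_simp
  ring
end
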